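/- For every positive integer n, in ℤ[q] one has 2 · ∑_{σ ∈ D_n} q^{exc^Abs(σ)} (−1)^{cyc(σ)} = −(q − 1)^{n−1} · ((1 + q)^n + (1 − q)^n), where D_n is the group of even signed permutations. -/

import Mathlib

open Finset Polynomial

/-- Number of excedances of a permutation: #{i : τ(i) > i}. -/
def exc {n : ℕ} (τ : Equiv.Perm (Fin n)) : ℕ :=
  (Finset.univ.filter fun i => i < τ i).card

/-- Number of cycles of a permutation, counting fixed points as cycles. -/
def cyc {n : ℕ} (τ : Equiv.Perm (Fin n)) : ℕ :=
  Multiset.card τ.cycleType + (Finset.univ.filter fun i => τ i = i).card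

/-- Color sum of a colored permutation. -/
def csum {r n : ℕ} (z : Fin n → Fin r) : ℕ := ∑ i, (z i : ℕ)

/-- #{i : z_i = 0 and τ(i) > i}. -/
def excA {r n : ℕ} (z : Fin n → Fin r) (τ : Equiv.Perm (Fin n)) : ℕ :=
  (Finset.univ.filter fun i => (z i : ℕ) = 0 ∧ i < τ i).card

/-- Excedance number with respect to the absolute order. -/
def excAbs {r n : ℕ} (z : Fin n → Fin r) (τ : Equiv.Perm (Fin n)) : ℕ :=
  exc τ + csum z

/-- Excedance number with respect to the color order. -/
def excClr {r n : ℕ} (z : Fin n → Fin r) (τ : Equiv.Perm (Fin n)) : ℕ :=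
  r * excA z τ + csum z

/-- The cycle parity of a permutation in terms of its sign. -/
lemma neg_one_pow_cyc {R : Type*} [CommRing R] {n : ℕ} (τ : Equiv.Perm (Fin n)) :
    (-1 : R) ^ cyc τ = (-1) ^ n * ((Equiv.Perm.sign τ : ℤ) : R) := by
  have hcard : τ.support.card + (Finset.univ.filter fun i => τ i = i).card = n := by
    have h := Finset.card_filter_add_card_filter_not (s := Finset.univ) (fun i => τ i = i)
    rw [Finset.card_univ, Fintype.card_fin] at h
    rw [add_comm]
    exact h
  set f := (Finset.univ.filter fun i => τ i = i).card with hf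
  have hsign : ((Equiv.Perm.sign τ : ℤ) : R) =
      (-1) ^ (τ.support.card + Multiset.card τ.cycleType) := by
    rw [Equiv.Perm.sign_of_cycleType, Equiv.Perm.sum_cycleType]
    push_cast
    rfl
  have hexp : n + (τ.support.card + Multiset.card τ.cycleType) =
      2 * τ.support.card + cyc τ := by
    unfold cyc
    omega
  rw [hsign, ← pow_add, hexp, pow_add, pow_mul]
  simp

/-- The determinant of the matrix with `q` strictly below the diagonal and `1` elsewhere. -/
lemma det_of_ite_lt {R : Type*} [CommRing R] (q : R) (m : ℕ) :
    (Matrix.of fun j i : Fin (m + 1) => if i < j then q else 1).det = (1 - q) ^ m := by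
  let B : Matrix (Fin (m + 1)) (Fin (m + 1)) R := Matrix.of fun j i =>
    Fin.cases (if 0 < j then q else 1)
      (fun k => (if k.succ < j then q else 1) - (if k.castSucc < j then q else 1)) i
  have hdet : (Matrix.of fun j i : Fin (m + 1) => if i < j then q else 1).det = B.det := by
    refine Matrix.det_eq_of_forall_col_eq_smul_add_pred (fun _ => 1) ?_ ?_ <;> simp [B]
  have htri : B.BlockTriangular OrderDual.toDual := by
    intro j i hij
    have hji : j < i := hij
    induction i using Fin.cases with
    | zero => simp at hji
    | succ k =>
      have h1 : ¬ k.succ < j := hji.asymm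
      have h2 : ¬ k.castSucc < j := by
        simp only [Fin.lt_def, Fin.val_succ, Fin.val_castSucc] at hji ⊢
        omega
      simp [B, h1, h2]
  rw [hdet, Matrix.det_of_isLowerTriangular B htri, Fin.prod_univ_succ]
  simp [B]

/-- The generating polynomial of excedances signed by the number of cycles. -/
lemma sum_pow_exc_mul_neg_one_pow_cyc {R : Type*} [CommRing R] (q : R) {n : ℕ} (hn : 0 < n) :
    ∑ τ : Equiv.Perm (Fin n), q ^ exc τ * (-1) ^ cyc τ = -(q - 1) ^ (n - 1) := by
  obtain ⟨m, rfl⟩ := Nat.exists_eq_succ_of_ne_zero hn.ne'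
  simp only [Nat.succ_eq_add_one, Nat.add_sub_cancel]
  have hsum : ∑ τ : Equiv.Perm (Fin (m + 1)), q ^ exc τ * (-1) ^ cyc τ =
      (-1) ^ (m + 1) *
        (Matrix.of fun j i : Fin (m + 1) => if i < j then q else 1).det := by
    rw [Matrix.det_apply', Finset.mul_sum]
    refine Finset.sum_congr rfl fun τ _ => ?_
    simp only [neg_one_pow_cyc, Matrix.of_apply, Finset.prod_ite, Finset.prod_const, one_pow,
      mul_one, exc]
    ring
  rw [hsum, det_of_ite_lt, ← neg_sub 1 q, neg_pow (1 - q)]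
  ring

/-- The generating function of the color sum over two colors. -/
lemma sum_pow_csum {R : Type*} [CommRing R] (q : R) (n : ℕ) :
    ∑ z : Fin n → Fin 2, q ^ csum z = (1 + q) ^ n := by
  simp only [csum, ← Finset.prod_pow_eq_pow_sum]
  rw [← Fintype.prod_sum (fun (_ : Fin n) (c : Fin 2) => q ^ (c : ℕ))]
  simp

/-- Twice the generating function of even color sums. -/
lemma two_mul_sum_even_pow_csum {R : Type*} [CommRing R] (q : R) (n : ℕ) :
    2 * ∑ z : Fin n → Fin 2 with Even (csum z), q ^ csum z = (1 + q) ^ n + (1 - q) ^ n := by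
  rw [sub_eq_add_neg, ← sum_pow_csum q, ← sum_pow_csum (-q), ← Finset.sum_add_distrib,
    Finset.mul_sum, Finset.sum_filter]
  refine Finset.sum_congr rfl fun z _ => ?_
  split_ifs with h
  · rw [h.neg_pow, two_mul]
  · rw [(Nat.not_even_iff_odd.mp h).neg_pow, add_neg_cancel]

theorem stmt10 (n : ℕ) (hn : 0 < n) :
    2 * ∑ σ ∈ Finset.univ.filter
        (fun σ : (Fin n → Fin 2) × Equiv.Perm (Fin n) => Even (csum σ.1)),
      (X : Polynomial ℤ) ^ excAbs σ.1 σ.2 * (-1) ^ cyc σ.2 =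
    -((X : Polynomial ℤ) - 1) ^ (n - 1) *
      ((1 + (X : Polynomial ℤ)) ^ n + (1 - (X : Polynomial ℤ)) ^ n) := by
  have hprod : (Finset.univ.filter
      fun σ : (Fin n → Fin 2) × Equiv.Perm (Fin n) => Even (csum σ.1)) =
      (Finset.univ.filter fun z : Fin n → Fin 2 => Even (csum z)) ×ˢ Finset.univ := by
    ext σ
    simp
  rw [← two_mul_sum_even_pow_csum, ← sum_pow_exc_mul_neg_one_pow_cyc X hn, hprod,
    Finset.sum_product, mul_left_comm, mul_comm (∑ τ, _), Finset.sum_mul_sum]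
  refine congrArg (2 * ·) (Finset.sum_congr rfl fun z _ => Finset.sum_congr rfl fun τ _ => ?_)
  rw [excAbs, add_comm, pow_add, mul_assoc]
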